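/- arXiv:1002.2797 — 2 statements merged into one kernel-verified Lean document; each statement's English description precedes it below -/
import Mathlib

section
/- Let p be a prime with p ≡ 3 (mod 4), n an even positive integer, and f : F_{p^n} → F_p a weakly regular bent function with W_f(b) = u (−p)^{n/2} ω_p^{f*(b)} for all b (u ∈ {1,−1}), such that f(tx) = t^k f(x) for all t ∈ F_p, x ∈ F_{p^n} with gcd(k−1,p−1) = 1. Then in the complex group algebra ℂ[(F_{p^n},+)]: L_R² = u·(−p)^{n/2}·(((p−3)/4)·L_R + ((p+1)/4)·L_N); L_N² = u·(−p)^{n/2}·(((p+1)/4)·L_R + ((p−3)/4)·L_N); and L_R·L_N = u·(−p)^{n/2}·(((p−3)/4)·L_R + ((p−3)/4)·L_N) + ((p−1)/2)·p^n·[0]. -/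
open Finset

noncomputable section
open scoped Classical

noncomputable instance (p n : ℕ) [Fact p.Prime] : Fintype (GaloisField p n) :=
  Fintype.ofFinite _

/-- `ω_p^a` for `a ∈ F_p`, where `ω_p = exp(2πi/p)`. -/
def ez (p : ℕ) (a : ZMod p) : ℂ :=
  Complex.exp (2 * Real.pi * Complex.I * (a.val : ℂ) / p)

/-- The Walsh coefficient `W_f(b) = ∑_{x∈F_{p^n}} ω_p^{f(x)+Tr(bx)}`. -/
def walsh (p n : ℕ) [Fact p.Prime] (f : GaloisField p n → ZMod p) (b : GaloisField p n) : ℂ :=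
  ∑ x : GaloisField p n,
    ez p (f x + Algebra.trace (ZMod p) (GaloisField p n) (b * x))

/-- The quadratic Gauss sum `G = ∑_{t∈F_p} ω_p^{t²}`. -/
def gaussSum' (p : ℕ) [NeZero p] : ℂ := ∑ t : ZMod p, ez p (t ^ 2)

/-- `L_t = ∑_{x∈F_{p^n}} ω_p^{t f(x)} x`, as an element of the group algebra
`ℂ[(F_{p^n},+)]`. -/
def Lelt (p n : ℕ) [Fact p.Prime] (f : GaloisField p n → ZMod p) (t : ZMod p) :
    AddMonoidAlgebra ℂ (GaloisField p n) :=
  ∑ x : GaloisField p n, AddMonoidAlgebra.single x (ez p (t * f x))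

/-- `L_R = ∑_{t∈R} L_t`, `R` the set of nonzero squares of `F_p`. -/
def LR (p n : ℕ) [Fact p.Prime] (f : GaloisField p n → ZMod p) :
    AddMonoidAlgebra ℂ (GaloisField p n) :=
  ∑ t ∈ Finset.univ.filter fun t : ZMod p => t ≠ 0 ∧ IsSquare t, Lelt p n f t

/-- `L_N = ∑_{t∈N} L_t`, `N` the set of nonsquares of `F_p`. -/
def LN (p n : ℕ) [Fact p.Prime] (f : GaloisField p n → ZMod p) :
    AddMonoidAlgebra ℂ (GaloisField p n) :=
  ∑ t ∈ Finset.univ.filter fun t : ZMod p => ¬IsSquare t, Lelt p n f t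

lemma ez_eq_stdAddChar (p : ℕ) [NeZero p] (a : ZMod p) : ez p a = ZMod.stdAddChar a := by
  rw [ez, ZMod.stdAddChar_apply, ZMod.toCircle_apply]

lemma stdAddChar_mul_eq_pow (p : ℕ) [NeZero p] (s a : ZMod p) :
    ZMod.stdAddChar (s * a) = ((ZMod.stdAddChar (1 : ZMod p) : ℂ) ^ s.val) ^ a.val := by
  rw [← pow_mul, ← AddChar.map_nsmul_eq_pow]
  simp

lemma isPrimitiveRoot_stdAddChar_one (p : ℕ) [NeZero p] :
    IsPrimitiveRoot (ZMod.stdAddChar (1 : ZMod p) : ℂ) p := by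
  have h := ZMod.stdAddChar_coe (N := p) 1
  push_cast at h
  rw [h, mul_one]
  exact Complex.isPrimitiveRoot_exp p (NeZero.ne p)

/-- Galois conjugation of a character sum whose value is an integer multiple of a root of unity. -/
lemma sum_stdAddChar_mul_eq (p : ℕ) [Fact p.Prime] {X : Type*} [Fintype X] (g : X → ZMod p)
    (C : ℤ) (a : ZMod p) (h : ∑ x, (ZMod.stdAddChar (g x) : ℂ) = C * ZMod.stdAddChar a)
    {s : ZMod p} (hs : s ≠ 0) :
    ∑ x, (ZMod.stdAddChar (s * g x) : ℂ) = C * ZMod.stdAddChar (s * a) := by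
  have hζ := isPrimitiveRoot_stdAddChar_one p
  set ζ : ℂ := ZMod.stdAddChar (1 : ZMod p)
  let P : Polynomial ℤ :=
    ∑ x, Polynomial.X ^ (g x).val - Polynomial.C C * Polynomial.X ^ a.val
  have hP (z : ℂ) : Polynomial.aeval z P = ∑ x, z ^ (g x).val - C * z ^ a.val := by
    simp [P]
  have h0 : Polynomial.aeval ζ P = 0 := by
    rw [hP, sub_eq_zero]
    have h1 (j : ZMod p) : ζ ^ j.val = ZMod.stdAddChar j := by
      rw [← AddChar.map_nsmul_eq_pow]
      simp
    simpa only [h1] using h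
  have hcop : s.val.Coprime p := by
    refine ((Fact.out : p.Prime).coprime_iff_not_dvd.2 fun hd => hs ?_).symm
    rw [← ZMod.natCast_zmod_val s]
    exact (ZMod.natCast_eq_zero_iff _ _).2 hd
  have hdvd := minpoly.isIntegrallyClosed_dvd
    (hζ.isIntegral (Fact.out : p.Prime).pos) h0
  rw [hζ.minpoly_eq_pow_coprime hcop] at hdvd
  have h1 : Polynomial.aeval (ζ ^ s.val) P = 0 := by
    obtain ⟨Q, hQ⟩ := hdvd
    rw [hQ, map_mul, minpoly.aeval, zero_mul]
  rw [hP, sub_eq_zero] at h1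
  simpa only [stdAddChar_mul_eq_pow] using h1

/-- The canonical additive character `x ↦ ω_p^{Tr x}` of `F_{p^n}`. -/
def traceChar (p n : ℕ) [Fact p.Prime] : AddChar (GaloisField p n) ℂ :=
  ZMod.stdAddChar.compAddMonoidHom (Algebra.trace (ZMod p) (GaloisField p n)).toAddMonoidHom

lemma traceChar_apply (p n : ℕ) [Fact p.Prime] (x : GaloisField p n) :
    traceChar p n x = ZMod.stdAddChar (Algebra.trace (ZMod p) (GaloisField p n) x) := rfl

lemma isPrimitive_traceChar (p n : ℕ) [Fact p.Prime] : (traceChar p n).IsPrimitive := by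
  refine AddChar.IsPrimitive.of_ne_one fun h => ?_
  obtain ⟨x, hx⟩ := Algebra.trace_surjective (ZMod p) (GaloisField p n) 1
  have h1 : traceChar p n x = 1 := by rw [h]; rfl
  rw [traceChar_apply, hx] at h1
  have hp : p = 1 := by
    have := (isPrimitiveRoot_stdAddChar_one p).eq_orderOf
    rwa [h1, orderOf_one] at this
  exact (Fact.out : p.Prime).one_lt.ne' hp

/-- The character of `ℂ[(F_{p^n},+)]` attached to `b`, sending `x` to `ω_p^{Tr(bx)}`. -/
def fourierHom (p n : ℕ) [Fact p.Prime] (b : GaloisField p n) :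
    AddMonoidAlgebra ℂ (GaloisField p n) →ₐ[ℂ] ℂ :=
  AddMonoidAlgebra.lift ℂ ℂ (GaloisField p n) ((traceChar p n).mulShift b).toMonoidHom

lemma fourierHom_single (p n : ℕ) [Fact p.Prime] (b x : GaloisField p n) (c : ℂ) :
    fourierHom p n b (AddMonoidAlgebra.single x c) = c * traceChar p n (b * x) := by
  rw [fourierHom, AddMonoidAlgebra.lift_single]
  rfl

lemma sum_fourierHom_mul (p n : ℕ) [Fact p.Prime] (A : AddMonoidAlgebra ℂ (GaloisField p n))
    (y : GaloisField p n) :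
    ∑ b, fourierHom p n b A * traceChar p n (b * -y)
      = Fintype.card (GaloisField p n) * A.coeff y := by
  induction A using AddMonoidAlgebra.induction_on with
  | of m =>
    have h (b : GaloisField p n) :
        fourierHom p n b (AddMonoidAlgebra.of ℂ _ (Multiplicative.ofAdd m)) * traceChar p n (b * -y)
          = traceChar p n (b * (m - y)) := by
      rw [AddMonoidAlgebra.of_apply, fourierHom_single, one_mul, ← AddChar.map_add_eq_mul]
      congr 1
      simp only [toAdd_ofAdd]
      ring
    simp only [h, AddChar.sum_mulShift _ (isPrimitive_traceChar p n), sub_eq_zero]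
    by_cases hmy : m = y <;> simp [hmy]
  | add A B hA hB => simp only [map_add, add_mul, sum_add_distrib, hA, hB]; simp [mul_add]
  | smul r A hA =>
    simp only [map_smul, smul_eq_mul, mul_assoc, ← mul_sum, hA]
    simp
    ring

lemma ext_fourierHom (p n : ℕ) [Fact p.Prime] {A B : AddMonoidAlgebra ℂ (GaloisField p n)}
    (h : ∀ b, fourierHom p n b A = fourierHom p n b B) : A = B := by
  ext y
  have h1 := sum_fourierHom_mul p n A y
  simp only [h] at h1
  rw [sum_fourierHom_mul] at h1
  exact (mul_left_cancel₀ (Nat.cast_ne_zero.2 Fintype.card_ne_zero) h1).symm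

lemma fourierHom_Lelt (p n : ℕ) [Fact p.Prime] (f : GaloisField p n → ZMod p) (t : ZMod p)
    (b : GaloisField p n) :
    fourierHom p n b (Lelt p n f t) =
      ∑ x, ZMod.stdAddChar (t * f x + Algebra.trace (ZMod p) (GaloisField p n) (b * x)) := by
  simp only [Lelt, map_sum, fourierHom_single, ez_eq_stdAddChar, traceChar_apply,
    AddChar.map_add_eq_mul]

lemma fourierHom_Lelt_inv_pow (p n : ℕ) [Fact p.Prime] (f : GaloisField p n → ZMod p) (k : ℕ)
    (hk : 0 < k)
    (hhom : ∀ (t : ZMod p) (x : GaloisField p n),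
      f (algebraMap (ZMod p) (GaloisField p n) t * x) = t ^ k * f x)
    (b : GaloisField p n) (C : ℤ) (a : ZMod p)
    (hW : walsh p n f b = C * ez p a) {s : ZMod p} (hs : s ≠ 0) :
    fourierHom p n b (Lelt p n f (s⁻¹ ^ (k - 1))) = C * ZMod.stdAddChar (s * a) := by
  simp only [walsh, ez_eq_stdAddChar] at hW
  rw [← sum_stdAddChar_mul_eq p _ C a hW hs, fourierHom_Lelt]
  have hs' : algebraMap (ZMod p) (GaloisField p n) s ≠ 0 := by simpa using hs
  symm
  refine Fintype.sum_equiv (Equiv.mulLeft₀ _ hs') _ _ fun x => ?_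
  congr 1
  simp only [Equiv.mulLeft₀_apply]
  rw [hhom, mul_left_comm b, ← Algebra.smul_def s (b * x), map_smul,
    smul_eq_mul, mul_add, ← mul_assoc]
  congr 2
  obtain ⟨k, rfl⟩ := Nat.exists_eq_succ_of_ne_zero hk.ne'
  rw [Nat.succ_sub_one, pow_succ, ← mul_assoc, ← mul_pow, inv_mul_cancel₀ hs, one_pow, one_mul]

lemma eq_of_pow_eq_of_coprime (p : ℕ) [Fact p.Prime] {m : ℕ} (hm : m.gcd (p - 1) = 1)
    {a b : ZMod p} (ha : a ≠ 0) (hb : b ≠ 0) (h : a ^ m = b ^ m) : a = b := by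
  have h1 : (a / b) ^ m.gcd (p - 1) = 1 := by
    rw [pow_gcd_eq_one, div_pow, h]
    exact ⟨div_self (pow_ne_zero _ hb), ZMod.pow_card_sub_one_eq_one (div_ne_zero ha hb)⟩
  rw [hm, pow_one] at h1
  exact (div_eq_one_iff_eq hb).1 h1

lemma fourierHom_sum_Lelt (p n : ℕ) [Fact p.Prime] (f : GaloisField p n → ZMod p) (k : ℕ)
    (hk : 0 < k) (hkgcd : Nat.gcd (k - 1) (p - 1) = 1)
    (hhom : ∀ (t : ZMod p) (x : GaloisField p n),
      f (algebraMap (ZMod p) (GaloisField p n) t * x) = t ^ k * f x)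
    (b : GaloisField p n) (C : ℤ) (a : ZMod p)
    (hW : walsh p n f b = C * ez p a) (S : Finset (ZMod p)) (hS0 : ∀ s ∈ S, s ≠ 0)
    (hS : ∀ s ∈ S, s⁻¹ ^ (k - 1) ∈ S) :
    fourierHom p n b (∑ t ∈ S, Lelt p n f t) = C * ∑ s ∈ S, ZMod.stdAddChar (s * a) := by
  rw [map_sum, mul_sum]
  have hinj : Set.InjOn (fun s : ZMod p => s⁻¹ ^ (k - 1)) (S : Set (ZMod p)) := fun s hs t ht h =>
    inv_injective (eq_of_pow_eq_of_coprime p hkgcd (inv_ne_zero (hS0 s hs))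
      (inv_ne_zero (hS0 t ht)) h)
  symm
  exact sum_nbij (fun s => s⁻¹ ^ (k - 1)) hS hinj
    (surjOn_of_injOn_of_card_le _ hS hinj le_rfl)
    fun s hs => (fourierHom_Lelt_inv_pow p n f k hk hhom b C a hW (hS0 s hs)).symm

/-- The Gaussian period over the nonzero squares. -/
def squarePeriod (p : ℕ) [Fact p.Prime] (a : ZMod p) : ℂ :=
  ∑ s ∈ univ.filter fun t : ZMod p => t ≠ 0 ∧ IsSquare t, ZMod.stdAddChar (s * a)

/-- The Gaussian period over the nonsquares. -/
def nonsquarePeriod (p : ℕ) [Fact p.Prime] (a : ZMod p) : ℂ :=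
  ∑ s ∈ univ.filter fun t : ZMod p => ¬IsSquare t, ZMod.stdAddChar (s * a)

lemma squarePeriod_add_nonsquarePeriod (p : ℕ) [Fact p.Prime] (a : ZMod p) :
    squarePeriod p a + nonsquarePeriod p a = (if a = 0 then (p : ℂ) else 0) - 1 := by
  have h := AddChar.sum_mulShift a (ZMod.isPrimitive_stdAddChar p)
  rw [ZMod.card, Nat.cast_ite, Nat.cast_zero] at h
  have h0 : (1 : ℂ) = ∑ s : ZMod p, if s = 0 then ZMod.stdAddChar (s * a) else 0 := by simp
  rw [← h, h0, ← sum_sub_distrib, squarePeriod, nonsquarePeriod, sum_filter, sum_filter,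
    ← sum_add_distrib]
  refine sum_congr rfl fun s _ => ?_
  by_cases hs : s = 0
  · simp [hs]
  · by_cases hq : IsSquare s <;> simp [hs, hq]

lemma squarePeriod_sub_nonsquarePeriod (p : ℕ) [Fact p.Prime] (a : ZMod p) :
    squarePeriod p a - nonsquarePeriod p a =
      gaussSum ((quadraticChar (ZMod p)).ringHomComp (Int.castRingHom ℂ))
        (ZMod.stdAddChar.mulShift a) := by
  rw [gaussSum, squarePeriod, nonsquarePeriod, sum_filter, sum_filter, ← sum_sub_distrib]
  refine sum_congr rfl fun s _ => ?_
  rw [AddChar.mulShift_apply, mul_comm a s, MulChar.ringHomComp_apply]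
  by_cases hs : s = 0
  · simp [hs]
  · by_cases hq : IsSquare s
    · simp [hs, hq, (quadraticChar_one_iff_isSquare hs).2 hq]
    · simp [hq, quadraticChar_neg_one_iff_not_isSquare.2 hq]

lemma squarePeriod_sub_nonsquarePeriod_sq (p : ℕ) [Fact p.Prime] (hp4 : p % 4 = 3)
    (a : ZMod p) :
    (squarePeriod p a - nonsquarePeriod p a) ^ 2 = if a = 0 then 0 else -(p : ℂ) := by
  have hp2 : ringChar (ZMod p) ≠ 2 := by
    rw [ZMod.ringChar_zmod_n]
    omega
  rw [squarePeriod_sub_nonsquarePeriod]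
  split_ifs with ha
  · have h := congrArg (Int.cast : ℤ → ℂ) (quadraticChar_sum_zero hp2)
    push_cast at h
    simp [ha, gaussSum, MulChar.ringHomComp_apply, h, -quadraticChar_apply]
  · rw [gaussSum_sq _ ((quadraticChar_isQuadratic _).comp _)
      (AddChar.IsPrimitive.of_ne_one (ZMod.isPrimitive_stdAddChar p ha)), ZMod.card,
      MulChar.ringHomComp_apply, quadraticChar_neg_one hp2, ZMod.card,
      ZMod.χ₄_nat_three_mod_four hp4]
    · simp
    · exact (MulChar.ringHomComp_ne_one_iff (RingHom.injective_int _)).2 (quadraticChar_ne_one hp2)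

/-- Identities in Case 2 of the proof of Theorem 3.5 (`p ≡ 3 (mod 4)`): in `ℂ[(F_{p^n},+)]`,
`L_R² = u(−p)^{n/2}(((p−3)/4)L_R + ((p+1)/4)L_N)`,
`L_N² = u(−p)^{n/2}(((p+1)/4)L_R + ((p−3)/4)L_N)`, and
`L_R L_N = u(−p)^{n/2}(((p−3)/4)L_R + ((p−3)/4)L_N) + ((p−1)/2)p^n·[0]`. -/
theorem LR_LN_identities_three_mod_four
    (p : ℕ) [Fact p.Prime] (hp4 : p % 4 = 3) (n : ℕ) (hn : 0 < n) (hneven : Even n)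
    (f fstar : GaloisField p n → ZMod p) (u : ℤ) (hu : u = 1 ∨ u = -1)
    (hW : ∀ b : GaloisField p n,
      walsh p n f b = (u : ℂ) * (-(p : ℂ)) ^ (n / 2) * ez p (fstar b))
    (k : ℕ) (hk : 0 < k) (hkgcd : Nat.gcd (k - 1) (p - 1) = 1)
    (hhom : ∀ (t : ZMod p) (x : GaloisField p n),
      f (algebraMap (ZMod p) (GaloisField p n) t * x) = t ^ k * f x) :
    LR p n f ^ 2
      = ((u : ℂ) * (-(p : ℂ)) ^ (n / 2)) •
          ((((p : ℂ) - 3) / 4) • LR p n f + (((p : ℂ) + 1) / 4) • LN p n f) ∧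
    LN p n f ^ 2
      = ((u : ℂ) * (-(p : ℂ)) ^ (n / 2)) •
          ((((p : ℂ) + 1) / 4) • LR p n f + (((p : ℂ) - 3) / 4) • LN p n f) ∧
    LR p n f * LN p n f
      = ((u : ℂ) * (-(p : ℂ)) ^ (n / 2)) •
          ((((p : ℂ) - 3) / 4) • LR p n f + (((p : ℂ) - 3) / 4) • LN p n f)
        + (((p : ℂ) - 1) / 2 * (p : ℂ) ^ n) • (1 : AddMonoidAlgebra ℂ (GaloisField p n)) := by
  obtain ⟨m, hm⟩ : Odd (k - 1) := by
    rw [← Nat.not_even_iff_odd]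
    intro h
    have h2 : 2 ∣ Nat.gcd (k - 1) (p - 1) := Nat.dvd_gcd h.two_dvd (by omega)
    omega
  have hR (b : GaloisField p n) : fourierHom p n b (LR p n f)
      = (u * (-(p : ℂ)) ^ (n / 2)) * squarePeriod p (fstar b) := by
    have h := fourierHom_sum_Lelt p n f k hk hkgcd hhom b (u * (-(p : ℤ)) ^ (n / 2)) (fstar b)
      (by push_cast; exact hW b) (univ.filter fun t : ZMod p => t ≠ 0 ∧ IsSquare t)
      (fun s hs => (mem_filter.1 hs).2.1) (by
        intro s hs
        rw [mem_filter] at hs ⊢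
        exact ⟨mem_univ _, pow_ne_zero _ (inv_ne_zero hs.2.1), hs.2.2.inv.pow _⟩)
    push_cast at h
    exact h
  have hN (b : GaloisField p n) : fourierHom p n b (LN p n f)
      = (u * (-(p : ℂ)) ^ (n / 2)) * nonsquarePeriod p (fstar b) := by
    have h := fourierHom_sum_Lelt p n f k hk hkgcd hhom b (u * (-(p : ℤ)) ^ (n / 2)) (fstar b)
      (by push_cast; exact hW b) (univ.filter fun t : ZMod p => ¬IsSquare t)
      (by
        rintro s hs rfl
        simp at hs) (by
        intro s hs
        rw [mem_filter] at hs ⊢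
        refine ⟨mem_univ _, fun hq => hs.2 ?_⟩
        have hs0 : s ≠ 0 := by
          rintro rfl
          exact hs.2 (IsSquare.zero)
        have hs' : s = (s⁻¹ ^ (k - 1))⁻¹ * (s⁻¹ ^ m * s⁻¹ ^ m) := by
          have hA : s⁻¹ ^ m ≠ 0 := pow_ne_zero _ (inv_ne_zero hs0)
          rw [hm, pow_succ, mul_inv, inv_inv, two_mul, pow_add]
          generalize s⁻¹ ^ m = A at *
          field_simp
        rw [hs']
        exact hq.inv.mul ⟨_, rfl⟩)
    push_cast at h
    exact h
  have hc : ((u : ℂ) * (-(p : ℂ)) ^ (n / 2)) ^ 2 = (p : ℂ) ^ n := by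
    have hu2 : (u : ℂ) ^ 2 = 1 := by rcases hu with rfl | rfl <;> simp
    rw [mul_pow, hu2, one_mul, ← pow_mul, Nat.div_mul_cancel hneven.two_dvd, hneven.neg_pow]
  rw [← hc]
  generalize (u : ℂ) * (-(p : ℂ)) ^ (n / 2) = c at hR hN
  refine ⟨ext_fourierHom p n fun b => ?_, ext_fourierHom p n fun b => ?_, ext_fourierHom p n fun b => ?_⟩ <;>
  · have hadd := squarePeriod_add_nonsquarePeriod p (fstar b)
    have hsub := squarePeriod_sub_nonsquarePeriod_sq p hp4 (fstar b)
    simp only [map_add, map_mul, map_pow, map_smul, map_one, smul_eq_mul, hR, hN]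
    generalize squarePeriod p (fstar b) = r at *
    generalize nonsquarePeriod p (fstar b) = q at *
    obtain rfl : q = (if fstar b = 0 then (p : ℂ) else 0) - 1 - r := by linear_combination hadd
    split_ifs at hsub ⊢
    · obtain rfl : r = ((p : ℂ) - 1) / 2 := by
        linear_combination (1 / 2) * (pow_eq_zero_iff two_ne_zero).1 hsub
      ring
    · first
        | linear_combination (c ^ 2 / 4) * hsub
        | linear_combination (-c ^ 2 / 4) * hsub
end
end

section
/- Let q be a power of an odd prime, n an even positive integer, and Q : F_q^n → F_q a nonsingular quadratic form. Then the set D = {x ∈ F_q^n : Q(x) is a nonzero square in F_q} is a partial difference set in (F_q^n, +); i.e., there exist λ, μ such that D is a (q^n, |D|, λ, μ) partial difference set. -/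
open Finset

noncomputable section
open scoped Classical

/-- `D` is a `(v,k,λ,μ)` partial difference set in the finite abelian group `G`:
every nonzero element of `D` is a difference of elements of `D` in exactly `λ` ways,
and every nonzero element outside `D` in exactly `μ` ways. -/
def IsPDS {G : Type*} [AddCommGroup G] [Fintype G] (D : Finset G) (v k lam mu : ℤ) : Prop :=
  (Fintype.card G : ℤ) = v ∧ (D.card : ℤ) = k ∧
    ∀ g : G, g ≠ 0 →
      ((((D ×ˢ D).filter fun xy => xy.1 - xy.2 = g).card : ℤ) = if g ∈ D then lam else mu)

/-- The canonical additive character `ψ₁(x) = ω_p^{Tr(x)}` of `F_{p^n}`,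
where `ω_p = exp(2πi/p)` and `Tr` is the absolute trace. -/
def psi (p n : ℕ) [Fact p.Prime] (x : GaloisField p n) : ℂ :=
  Complex.exp (2 * Real.pi * Complex.I *
    ((Algebra.trace (ZMod p) (GaloisField p n) x).val : ℂ) / p)

/-- The cyclotomic class `C_i = {g^{i+ej} : 0 ≤ j ≤ f-1}` of order `e`
with respect to the primitive element `g`. -/
def cycClass (p n : ℕ) [Fact p.Prime] (g : GaloisField p n) (e f i : ℕ) :
    Finset (GaloisField p n) :=
  (Finset.range f).image fun j => g ^ (i + e * j)

/-- The polar form `B(x,y) = Q(x+y) − Q(x) − Q(y)` of `Q`. -/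
def polarForm {F V : Type*} [Field F] [AddCommGroup V] (Q : V → F) (x y : V) : F :=
  Q (x + y) - Q x - Q y

section FourierQuadratic

open QuadraticMap (polar polar_comm polar_neg weightedSumSquares_apply)

variable {F V : Type*} [Field F] [AddCommGroup V] [Module F V] [Fintype V]

theorem sum_addChar_polar {ψ : AddChar F ℂ} (hψ : ψ.IsPrimitive) (Q : QuadraticForm F V)
    (hQ : ∀ x, (∀ y, polar Q x y = 0) → x = 0) (b : V) :
    ∑ x, ψ (polar Q b x) = if b = 0 then (Fintype.card V : ℂ) else 0 := by
  split_ifs with hb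
  · simp [hb]
  · obtain ⟨y, hy⟩ : ∃ y, polar Q b y ≠ 0 := by
      by_contra! h; exact hb (hQ b h)
    obtain ⟨a, ha⟩ := (AddChar.ne_one_iff).1 (hψ hy)
    have hne : ψ.compAddMonoidHom (Q.polarBilin b).toAddMonoidHom ≠ 1 := by
      refine AddChar.ne_one_iff.2 ⟨a • y, ?_⟩
      simpa [AddChar.mulShift_apply, mul_comm] using ha
    simpa using AddChar.sum_eq_zero_of_ne_one hne

theorem sum_addChar_quadraticForm_add_polar (ψ : AddChar F ℂ) (Q : QuadraticForm F V)
    (c : Fˣ) (b : V) :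
    ∑ x, ψ (c * Q x + polar Q b x) = ψ (-((c⁻¹ : Fˣ) * Q b)) * ∑ x, ψ (c * Q x) := by
  rw [mul_sum]
  refine Fintype.sum_equiv (Equiv.addRight ((c⁻¹ : Fˣ) • b)) _ _ fun x => ?_
  rw [← AddChar.map_add_eq_mul]
  congr 1
  have h1 : Q (x + (c⁻¹ : Fˣ) • b) =
      Q x + (c⁻¹ : Fˣ) * (c⁻¹ : Fˣ) * Q b + (c⁻¹ : Fˣ) * polar Q b x := by
    rw [QuadraticMap.map_add Q, Units.smul_def, QuadraticMap.map_smul, QuadraticMap.polar_smul_right,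
      polar_comm, smul_eq_mul, smul_eq_mul]
  simp only [Equiv.coe_addRight, h1]
  have hc : (c : F) * (c⁻¹ : Fˣ) = 1 := c.mul_inv
  linear_combination (-(((c⁻¹ : Fˣ) : F) * Q b) - polar Q b x) * hc

theorem card_mul_sum_convolution {ψ : AddChar F ℂ} (hψ : ψ.IsPrimitive)
    (Q : QuadraticForm F V) (hQ : ∀ x, (∀ y, polar Q x y = 0) → x = 0) (f : V → ℂ) (g : V) :
    (Fintype.card V : ℂ) * ∑ x, f x * f (g - x) =
      ∑ b, (∑ x, f x * ψ (polar Q b x)) ^ 2 * ψ (-polar Q b g) := by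
  have horth (y : V) : ∑ b, ψ (polar Q b y) = if y = 0 then (Fintype.card V : ℂ) else 0 := by
    simp_rw [polar_comm Q _ y]; exact sum_addChar_polar hψ Q hQ y
  symm
  calc ∑ b, (∑ x, f x * ψ (polar Q b x)) ^ 2 * ψ (-polar Q b g)
      = ∑ b, ∑ x, ∑ y, f x * f y * ψ (polar Q b (y - (g - x))) := by
        refine sum_congr rfl fun b _ => ?_
        rw [sq, sum_mul_sum, sum_mul]
        refine sum_congr rfl fun x _ => ?_
        rw [sum_mul]
        refine sum_congr rfl fun y _ => ?_
        have : polar Q b (y - (g - x)) = polar Q b x + polar Q b y + -polar Q b g := by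
          rw [QuadraticMap.polar_sub_right, QuadraticMap.polar_sub_right]; ring
        rw [this, AddChar.map_add_eq_mul, AddChar.map_add_eq_mul]
        ring
    _ = ∑ x, ∑ y, f x * f y * ∑ b, ψ (polar Q b (y - (g - x))) := by
        rw [sum_comm]
        refine sum_congr rfl fun x _ => ?_
        rw [sum_comm]
        simp_rw [mul_sum]
    _ = _ := by
        simp_rw [horth, sub_eq_zero, mul_ite, mul_zero, sum_ite_eq', mem_univ, if_true, mul_sum]
        exact sum_congr rfl fun x _ => by ring

variable [Fintype F]

/-- The number of nonzero square roots of `a`. -/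
def unitSqrtCount (a : F) : ℂ := ∑ u : Fˣ, if (u : F) ^ 2 = a then 1 else 0

theorem unitSqrtCount_eq_ite (h2 : (2 : F) ≠ 0) (a : F) :
    unitSqrtCount a = if a ≠ 0 ∧ IsSquare a then 2 else 0 := by
  unfold unitSqrtCount
  split_ifs with h
  · obtain ⟨ha, d, rfl⟩ := h
    have hd : d ≠ 0 := fun h => ha (by simp [h])
    have hne : Units.mk0 d hd ≠ -Units.mk0 d hd := by
      intro h
      have h' : d = -d := congrArg Units.val h
      have : 2 * d = 0 := by linear_combination h'
      exact (mul_ne_zero h2 hd) this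
    have hs : (univ.filter fun u : Fˣ => (u : F) ^ 2 = d * d) =
        {Units.mk0 d hd, -Units.mk0 d hd} := by
      ext u
      simp only [mem_filter, mem_univ, true_and, mem_insert, mem_singleton, Units.ext_iff,
        Units.val_neg, Units.val_mk0, ← sq, sq_eq_sq_iff_eq_or_eq_neg]
    rw [Finset.sum_boole, hs, Finset.card_pair hne]
    norm_num
  · refine Finset.sum_eq_zero fun u _ => if_neg fun hu => h ⟨?_, u, ?_⟩
    · rw [← hu]; exact pow_ne_zero _ u.ne_zero
    · rw [← hu, sq]

theorem sum_eq_zero_add_sum_units (f : F → ℂ) : ∑ c, f c = f 0 + ∑ u : Fˣ, f u := by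
  rw [Fintype.sum_eq_add_sum_subtype_ne f 0]
  congr 1
  exact (Fintype.sum_equiv unitsEquivNeZero _ _ fun u => rfl).symm

theorem AddChar.apply_sum {A ι : Type*} [AddCommMonoid A] (ψ : AddChar A ℂ) (s : Finset ι)
    (f : ι → A) : ψ (∑ i ∈ s, f i) = ∏ i ∈ s, ψ (f i) := by
  induction s using Finset.induction_on with
  | empty => simp
  | insert a s ha ih => rw [sum_insert ha, prod_insert ha, AddChar.map_add_eq_mul, ih]

theorem sum_addChar_mul_sq (h2 : ringChar F ≠ 2) {ψ : AddChar F ℂ} (hψ : ψ.IsPrimitive)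
    (c : Fˣ) : ∑ y : F, ψ (c * y ^ 2) = (quadraticChar F c : ℂ) * ∑ y : F, ψ (y ^ 2) := by
  set χ : MulChar F ℂ := (quadraticChar F).ringHomComp (Int.castRingHom ℂ) with hχ
  have key (c : Fˣ) : ∑ y : F, ψ (c * y ^ 2) = gaussSum χ (ψ.mulShift c) := by
    have hsqrt (a : F) : ∑ y : F, (if y ^ 2 = a then (1 : ℂ) else 0) = χ a + 1 := by
      have := quadraticChar_card_sqrts h2 a
      rw [Finset.sum_boole]
      have h' : (univ.filter fun y : F => y ^ 2 = a) = {x | x ^ 2 = a}.toFinset := by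
        ext; simp
      rw [h', hχ, MulChar.ringHomComp_apply]
      simpa using congrArg (Int.cast : ℤ → ℂ) this
    have hz : ∑ a : F, ψ (c * a) = 0 := by
      have := AddChar.sum_mulShift (c : F) hψ
      simp only [c.ne_zero, if_false, Nat.cast_zero] at this
      simpa [mul_comm] using this
    calc ∑ y : F, ψ (c * y ^ 2)
        = ∑ y : F, ∑ a : F, (if y ^ 2 = a then (1 : ℂ) else 0) * ψ (c * a) := by
          simp
      _ = ∑ a : F, (χ a + 1) * ψ (c * a) := by
          rw [sum_comm]; simp_rw [← sum_mul, hsqrt]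
      _ = gaussSum χ (ψ.mulShift c) := by
          simp_rw [add_mul, one_mul, sum_add_distrib, hz, add_zero, gaussSum,
            AddChar.mulShift_apply]
  have h1 : ∑ y : F, ψ (y ^ 2) = gaussSum χ ψ := by
    simpa using key 1
  have hc : χ c * χ c = 1 := by
    rw [hχ, MulChar.ringHomComp_apply, ← map_mul, ← sq, quadraticChar_sq_one c.ne_zero, map_one]
  rw [key, h1, ← gaussSum_mulShift χ ψ c]
  change _ = χ c * _
  rw [← mul_assoc, hc, one_mul]

theorem sum_addChar_smul_quadraticForm (h2 : (2 : F) ≠ 0) {ψ : AddChar F ℂ}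
    (hψ : ψ.IsPrimitive) (Q : QuadraticForm F V) (hQ : ∀ x, (∀ y, polar Q x y = 0) → x = 0)
    (heven : Even (Module.finrank F V)) (c : Fˣ) :
    ∑ x, ψ (c * Q x) = ∑ x, ψ (Q x) := by
  have h2' : ringChar F ≠ 2 := fun h => h2 (by
    have := ringChar.Nat.cast_ringChar (R := F); rw [h] at this; exact_mod_cast this)
  let _ : Invertible (2 : F) := invertibleOfNonzero h2
  have hsep : LinearMap.SeparatingLeft (QuadraticMap.associated (R := F) Q) := by
    intro x hx
    refine hQ x fun y => ?_
    have := LinearMap.congr_fun₂ (QuadraticMap.two_nsmul_associated F Q) x y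
    rw [← QuadraticMap.polarBilin_apply_apply, ← this, two_nsmul]
    exact (congrArg₂ (· + ·) (hx y) (hx y)).trans (add_zero 0)
  obtain ⟨w, ⟨e⟩⟩ := QuadraticForm.equivalent_weightedSumSquares_units_of_nondegenerate' Q hsep
  have key (c : Fˣ) : ∑ x, ψ (c * Q x) =
      ∏ i, ((quadraticChar F (c * w i : F) : ℂ) * ∑ y : F, ψ (y ^ 2)) := by
    calc ∑ x, ψ (c * Q x) = ∑ v : Fin (Module.finrank F V) → F,
          ∏ i, ψ ((c * w i : Fˣ) * v i ^ 2) := by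
          refine Fintype.sum_equiv e.toLinearEquiv.toEquiv _ _ fun x => ?_
          rw [← AddChar.apply_sum, ← e.map_app x, weightedSumSquares_apply, mul_sum]
          congr 1
          refine sum_congr rfl fun i _ => ?_
          simp only [Units.smul_def, smul_eq_mul, Units.val_mul]
          change _ = _ * (e x i) ^ 2
          ring
      _ = _ := by
          rw [← Fintype.piFinset_univ,
            ← Finset.prod_univ_sum (fun _ => univ) fun i y => ψ ((c * w i : Fˣ) * y ^ 2)]
          exact prod_congr rfl fun i _ => by
            rw [sum_addChar_mul_sq h2' hψ, Units.val_mul]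
  have h1 := key 1
  simp only [Units.val_one, one_mul] at h1
  rw [key, h1]
  simp_rw [map_mul, Int.cast_mul, mul_assoc]
  rw [prod_mul_distrib, prod_const, card_univ, Fintype.card_fin]
  have hc : (quadraticChar F c : ℂ) ^ Module.finrank F V = 1 := by
    obtain ⟨k, hk⟩ := heven
    rw [hk, ← two_mul, pow_mul, ← Int.cast_pow, quadraticChar_sq_one c.ne_zero]
    simp
  rw [hc, one_mul]

/-- The Fourier transform of the number of nonzero square roots of `Q x`, taken with respect to the
pairing `ψ (polar Q b x)`. -/
theorem sum_unitSqrtCount_mul_addChar (h2 : (2 : F) ≠ 0) {ψ : AddChar F ℂ}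
    (hψ : ψ.IsPrimitive) (Q : QuadraticForm F V) (hQ : ∀ x, (∀ y, polar Q x y = 0) → x = 0)
    (heven : Even (Module.finrank F V)) {b : V} (hb : b ≠ 0) :
    (Fintype.card F : ℂ) * ∑ x, unitSqrtCount (Q x) * ψ (polar Q b x) =
      (∑ x, ψ (Q x)) *
        (Fintype.card F * unitSqrtCount (-Q b) - Fintype.card Fˣ) := by
  have horth (a : F) : ∑ c, ψ (c * a) = (Fintype.card F : ℂ) * if a = 0 then 1 else 0 := by
    rw [AddChar.sum_mulShift a hψ]; split_ifs <;> simp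
  have hcount (a : F) : (Fintype.card F : ℂ) * unitSqrtCount a =
      ∑ u : Fˣ, ∑ c, ψ (c * (a - (u : F) ^ 2)) := by
    simp_rw [horth, unitSqrtCount, mul_sum, sub_eq_zero, eq_comm]
  have hinner (u : Fˣ) : ∑ c : F, ∑ x, ψ (c * (Q x - (u : F) ^ 2)) * ψ (polar Q b x) =
      (∑ x, ψ (Q x)) * ∑ c : Fˣ, ψ (-((c⁻¹ : Fˣ) * ((c * u : Fˣ) ^ 2 + Q b))) := by
    rw [sum_eq_zero_add_sum_units]
    simp only [zero_mul, AddChar.map_zero_eq_one, one_mul]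
    rw [sum_addChar_polar hψ Q hQ, if_neg hb, zero_add, mul_sum]
    refine sum_congr rfl fun c _ => ?_
    have := sum_addChar_quadraticForm_add_polar ψ Q c b
    rw [sum_addChar_smul_quadraticForm h2 hψ Q hQ heven] at this
    calc ∑ x, ψ (c * (Q x - (u : F) ^ 2)) * ψ (polar Q b x)
        = ψ (-(c * (u : F) ^ 2)) * ∑ x, ψ (c * Q x + polar Q b x) := by
          rw [mul_sum]
          refine sum_congr rfl fun x _ => ?_
          rw [← AddChar.map_add_eq_mul, ← AddChar.map_add_eq_mul]
          congr 1; ring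
      _ = _ := by
          rw [this, ← mul_assoc, ← AddChar.map_add_eq_mul, mul_comm]
          congr 2
          have hc : (c : F) * (c⁻¹ : Fˣ) = 1 := c.mul_inv
          push_cast at hc ⊢
          linear_combination (c * (u : F) ^ 2) * hc
  calc (Fintype.card F : ℂ) * ∑ x, unitSqrtCount (Q x) * ψ (polar Q b x)
      = ∑ u : Fˣ, ∑ c : F, ∑ x, ψ (c * (Q x - (u : F) ^ 2)) * ψ (polar Q b x) := by
        simp_rw [mul_sum, ← mul_assoc, hcount, sum_mul]
        rw [sum_comm]
        exact sum_congr rfl fun u _ => sum_comm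
    _ = (∑ x, ψ (Q x)) *
          ∑ c : Fˣ, ∑ u : Fˣ, ψ (-((c⁻¹ : Fˣ) * ((c * u : Fˣ) ^ 2 + Q b))) := by
        simp_rw [hinner, ← mul_sum]
        rw [sum_comm]
    _ = (∑ x, ψ (Q x)) * ∑ c : Fˣ, ∑ u : Fˣ, ψ (c * ((u : F) ^ 2 + Q b)) := by
        congr 1
        refine Fintype.sum_equiv ((Equiv.inv Fˣ).trans (Equiv.neg Fˣ)) _ _ fun c => ?_
        refine Fintype.sum_equiv (Equiv.mulLeft c) _ _ fun u => ?_
        congr 1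
        simp
    _ = _ := by
        congr 1
        rw [sum_comm, hcount, sum_comm]
        rw [sum_comm, eq_sub_iff_add_eq, ← card_univ, ← nsmul_one, ← sum_const,
          ← sum_add_distrib]
        refine sum_congr rfl fun u _ => ?_
        have h1 := sum_eq_zero_add_sum_units fun c => ψ (c * ((u : F) ^ 2 + Q b))
        simp only [zero_mul, AddChar.map_zero_eq_one] at h1
        rw [add_comm, ← h1]
        refine Fintype.sum_equiv (Equiv.neg F) _ _ fun c => ?_
        congr 1
        simp only [Equiv.neg_apply]; ring

theorem exists_sum_unitSqrtCount_convolution_eq (h2 : (2 : F) ≠ 0) (Q : QuadraticForm F V)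
    (hQ : ∀ x, (∀ y, polar Q x y = 0) → x = 0) (heven : Even (Module.finrank F V)) :
    ∃ α β : ℂ, ∀ g : V, g ≠ 0 →
      ∑ x, unitSqrtCount (Q x) * unitSqrtCount (Q (g - x)) = α + β * unitSqrtCount (Q g) := by
  obtain ⟨ψ, hψ⟩ : ∃ ψ : AddChar F ℂ, ψ.IsPrimitive :=
    ⟨_, AddChar.FiniteField.primitiveChar_to_Complex_isPrimitive F⟩
  set q : ℂ := (Fintype.card F : ℂ)
  set r : ℂ := (Fintype.card Fˣ : ℂ)
  set N : ℂ := (Fintype.card V : ℂ)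
  set G : ℂ := ∑ x, ψ (Q x) with hG
  have hq : q ≠ 0 := Nat.cast_ne_zero.2 Fintype.card_ne_zero
  have hN : N ≠ 0 := Nat.cast_ne_zero.2 Fintype.card_ne_zero
  set S : V → ℂ := fun b => ∑ x, unitSqrtCount (Q x) * ψ (polar Q b x) with hS
  have hQneg : ∀ x, (∀ y, polar (-Q) x y = 0) → x = 0 := fun x hx => hQ x fun y => by
    simpa [polar_neg] using hx y
  have hGneg : ∑ x, ψ ((-Q) x) = G := by
    rw [hG, ← sum_addChar_smul_quadraticForm h2 hψ Q hQ heven (-1)]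
    simp
  have hS_of_ne {b : V} (hb : b ≠ 0) : S b = G / q * (q * unitSqrtCount (-Q b) - r) := by
    have := sum_unitSqrtCount_mul_addChar h2 hψ Q hQ heven hb
    field_simp
    rw [mul_comm]
    exact this
  have hdual {g : V} (hg : g ≠ 0) : ∑ b, unitSqrtCount (-Q b) * ψ (-polar Q b g) =
      G / q * (q * unitSqrtCount (Q g) - r) := by
    have := sum_unitSqrtCount_mul_addChar h2 hψ (-Q) hQneg heven hg
    rw [hGneg] at this
    simp only [neg_apply, neg_neg, FunLike.coe_neg, polar_neg] at this
    simp_rw [polar_comm Q _ g]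
    field_simp
    rw [mul_comm]
    exact this
  have hsq (a : F) : unitSqrtCount a ^ 2 = 2 * unitSqrtCount a := by
    rw [unitSqrtCount_eq_ite h2]; split_ifs <;> norm_num
  have hzero : unitSqrtCount (-Q 0) = 0 := by
    rw [unitSqrtCount_eq_ite h2]; simp
  have hS_sq (b : V) : S b ^ 2 = (G / q) ^ 2 * (2 * q * unitSqrtCount (-Q b) + r ^ 2) +
      if b = 0 then S 0 ^ 2 - (G / q) ^ 2 * r ^ 2 else 0 := by
    split_ifs with hb
    · rw [hb, hzero]; ring
    · have hrq : r = q - 1 := by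
        simp only [r, q]
        rw [Fintype.card_units, Nat.cast_sub Fintype.card_pos, Nat.cast_one]
      rw [hS_of_ne hb, hrq]
      linear_combination (G / q) ^ 2 * q ^ 2 * hsq (-Q b)
  refine ⟨N⁻¹ * (S 0 ^ 2 - (G / q) ^ 2 * r ^ 2 - (G / q) ^ 3 * (2 * q * r)),
    N⁻¹ * ((G / q) ^ 3 * (2 * q ^ 2)), fun g hg => ?_⟩
  have htriv : ∑ b, ψ (-polar Q b g) = 0 := by
    have := sum_addChar_polar hψ (-Q) hQneg g
    rw [if_neg hg] at this
    simpa [polar_neg, polar_comm Q _ g] using this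
  have hconv := card_mul_sum_convolution hψ Q hQ (fun x => unitSqrtCount (Q x)) g
  have hexp : ∑ b, S b ^ 2 * ψ (-polar Q b g) =
      (G / q) ^ 2 * (2 * q) * ∑ b, unitSqrtCount (-Q b) * ψ (-polar Q b g) +
      (G / q) ^ 2 * r ^ 2 * ∑ b, ψ (-polar Q b g) + (S 0 ^ 2 - (G / q) ^ 2 * r ^ 2) := by
    have hz : ∑ b, (if b = 0 then S 0 ^ 2 - (G / q) ^ 2 * r ^ 2 else 0) * ψ (-polar Q b g) =
        S 0 ^ 2 - (G / q) ^ 2 * r ^ 2 := by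
      simp [ite_mul]
    conv_rhs => rw [← hz]
    rw [mul_sum, mul_sum, ← sum_add_distrib, ← sum_add_distrib]
    refine sum_congr rfl fun b _ => ?_
    rw [hS_sq b]; ring
  change N * _ = ∑ b, S b ^ 2 * ψ (-polar Q b g) at hconv
  rw [hexp, htriv, hdual hg] at hconv
  refine mul_left_cancel₀ hN ?_
  rw [hconv]
  field_simp
  ring

end FourierQuadratic

/-- **Construction 1.1 (affine polar graphs).**  Let `q` be a power of an odd prime, `n` an even
positive integer, and `Q : F_q^n → F_q` a nonsingular quadratic form.  Then
`D = {x ∈ F_q^n : Q(x) is a nonzero square}` is a partial difference set in `(F_q^n, +)`. -/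
theorem affine_polar_graph_PDS
    (p s : ℕ) [Fact p.Prime] (hp2 : p ≠ 2) (hs : 0 < s)
    (n : ℕ) (hn : 0 < n) (hneven : Even n)
    (Q : (Fin n → GaloisField p s) → GaloisField p s)
    (hQ : ∀ (a : GaloisField p s) x, Q (a • x) = a ^ 2 * Q x)
    (hBadd : ∀ x y z, polarForm Q (x + y) z = polarForm Q x z + polarForm Q y z)
    (hBsmul : ∀ (a : GaloisField p s) x y, polarForm Q (a • x) y = a * polarForm Q x y)
    (hBnd : ∀ x, (∀ y, polarForm Q x y = 0) → x = 0) :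
    ∃ lam mu : ℤ,
      IsPDS (Finset.univ.filter fun x => Q x ≠ 0 ∧ IsSquare (Q x))
        (((p : ℤ) ^ s) ^ n)
        (((Finset.univ.filter fun x => Q x ≠ 0 ∧ IsSquare (Q x)).card : ℤ))
        lam mu := by
  have h2 : (2 : GaloisField p s) ≠ 0 := fun h => hp2 <|
    (Nat.prime_dvd_prime_iff_eq Fact.out Nat.prime_two).1
      ((CharP.cast_eq_zero_iff (GaloisField p s) p 2).1 (by exact_mod_cast h))
  let Q' : QuadraticForm (GaloisField p s) (Fin n → GaloisField p s) :=
    QuadraticMap.ofPolar Q (fun a x => by rw [hQ, sq, smul_eq_mul]) hBadd hBsmul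
  have hQ' (x) : Q' x = Q x := rfl
  obtain ⟨α, β, h⟩ := exists_sum_unitSqrtCount_convolution_eq h2 Q' hBnd (by simpa using hneven)
  simp only [hQ', unitSqrtCount_eq_ite h2] at h
  set D := univ.filter fun x => Q x ≠ 0 ∧ IsSquare (Q x) with hD
  have hDmem (x) : x ∈ D ↔ Q x ≠ 0 ∧ IsSquare (Q x) := by simp [hD]
  simp only [← hDmem] at h
  have hQneg (x) : Q (-x) = Q x := QuadraticMap.map_neg Q' x
  have hcount (g) (hg : g ≠ 0) :
      4 * (((D ×ˢ D).filter fun xy => xy.1 - xy.2 = g).card : ℂ) =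
        α + β * if g ∈ D then 2 else 0 := by
    rw [← h g hg]
    have himage : (D ×ˢ D).filter (fun xy => xy.1 - xy.2 = g) =
        (univ.filter fun x => x ∈ D ∧ g - x ∈ D).image fun x => (x, x - g) := by
      ext ⟨x, y⟩
      simp only [mem_filter, mem_product, mem_image, mem_univ, true_and, Prod.mk.injEq]
      constructor
      · rintro ⟨⟨hx, hy⟩, rfl⟩
        refine ⟨x, ⟨hx, ?_⟩, rfl, by abel⟩
        rw [hDmem] at hy ⊢
        rwa [show x - y - x = -y by abel, hQneg]
      · rintro ⟨x, ⟨hx, hy⟩, rfl, rfl⟩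
        refine ⟨⟨hx, ?_⟩, by abel⟩
        rw [hDmem] at hy ⊢
        rwa [← hQneg, neg_sub]
    rw [himage, card_image_of_injective _ fun x y hxy => (Prod.mk.inj hxy).1, ← Finset.sum_boole,
      mul_sum]
    refine sum_congr rfl fun x _ => ?_
    by_cases hx : x ∈ D <;> by_cases hy : g - x ∈ D <;> (simp [hx, hy]; try norm_num)
  have hconst (g g') (hg : g ≠ 0) (hg' : g' ≠ 0) (hgg' : g ∈ D ↔ g' ∈ D) :
      ((D ×ˢ D).filter fun xy => xy.1 - xy.2 = g).card =
        ((D ×ˢ D).filter fun xy => xy.1 - xy.2 = g').card := by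
    have h1 := hcount g hg
    simp only [hgg'] at h1
    rw [← hcount g' hg'] at h1
    exact_mod_cast mul_left_cancel₀ (by norm_num) h1
  have hvalue (P : Prop) : ∃ c : ℤ, ∀ g, g ≠ 0 → (g ∈ D ↔ P) →
      (((D ×ˢ D).filter fun xy => xy.1 - xy.2 = g).card : ℤ) = c := by
    by_cases hex : ∃ g, g ≠ 0 ∧ (g ∈ D ↔ P)
    · obtain ⟨g₀, hg₀, hP⟩ := hex
      exact ⟨_, fun g hg hgP => congrArg Nat.cast (hconst g g₀ hg hg₀ (hgP.trans hP.symm))⟩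
    · exact ⟨0, fun g hg hgP => (hex ⟨g, hg, hgP⟩).elim⟩
  obtain ⟨lam, hlam⟩ := hvalue True
  obtain ⟨mu, hmu⟩ := hvalue False
  refine ⟨lam, mu, ?_, rfl, fun g hg => ?_⟩
  · rw [← Nat.card_eq_fintype_card, Nat.card_fun, GaloisField.card p s hs.ne', Nat.card_fin]
    push_cast
    rfl
  · split_ifs with hgD
    · convert hlam g hg (iff_true_intro hgD)
    · convert hmu g hg (iff_false_intro hgD)
end
end
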